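/- arXiv:2410.23362 — 3 statements merged into one kernel-verified Lean document; each statement's English description precedes it below -/
import Mathlib

section
/- Let w ∈ ℝ^n have all entries strictly positive, b ∈ ℝ, σ : ℝ → ℝ continuous satisfying the STFE property with σ(b) = 0, and f(x) = σ(wᵀx + b) on [0,1]^n. Then the piecewise-defined function g is concave on each of the regions R_f, R_l, R_1, …, R_n separately; moreover, on each of these regions R, g equals the concave envelope conc(f,R) of f over that region. -/
noncomputable section

/-- `φ` is the concave envelope of `f` over `S`: the pointwise smallest concave
function on `S` that majorizes `f` on `S`. -/
def IsConcaveEnvelope {E : Type*} [AddCommMonoid E] [Module ℝ E]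
    (S : Set E) (f φ : E → ℝ) : Prop :=
  ConcaveOn ℝ S φ ∧ (∀ x ∈ S, f x ≤ φ x) ∧
    ∀ h : E → ℝ, ConcaveOn ℝ S h → (∀ x ∈ S, f x ≤ h x) → ∀ x ∈ S, φ x ≤ h x

/-- `φ` is the convex envelope of `f` over `S`: the pointwise largest convex
function on `S` that minorizes `f` on `S`. -/
def IsConvexEnvelope {E : Type*} [AddCommMonoid E] [Module ℝ E]
    (S : Set E) (f φ : E → ℝ) : Prop :=
  ConvexOn ℝ S φ ∧ (∀ x ∈ S, φ x ≤ f x) ∧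
    ∀ h : E → ℝ, ConvexOn ℝ S h → (∀ x ∈ S, h x ≤ f x) → ∀ x ∈ S, h x ≤ φ x

/-- `zhat ∈ [ℓ,u]` witnesses the secant-then-function form of the concave
envelope of `σ` on `[ℓ,u]`. -/
def STFEwitness (σ : ℝ → ℝ) (ℓ u zhat : ℝ) : Prop :=
  zhat ∈ Set.Icc ℓ u ∧
    IsConcaveEnvelope (Set.Icc ℓ u) σ
      (fun z => if z < zhat then σ ℓ + (σ zhat - σ ℓ) / (zhat - ℓ) * (z - ℓ) else σ z)

/-- The secant-then-function envelope (STFE) property. -/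
def STFE (σ : ℝ → ℝ) : Prop :=
  ∀ ℓ u : ℝ, ℓ ≤ u → ∃ zhat, STFEwitness σ ℓ u zhat

/-- The tie point of `σ` over `[ℓ,u]`: the smallest STFE witness. -/
def IsTiePoint (σ : ℝ → ℝ) (ℓ u zhat : ℝ) : Prop :=
  STFEwitness σ ℓ u zhat ∧ ∀ z, STFEwitness σ ℓ u z → zhat ≤ z

/-- `σ` is S-shaped: convex then concave. -/
def SShaped (σ : ℝ → ℝ) : Prop :=
  ∃ zt : ℝ, ConvexOn ℝ (Set.Iic zt) σ ∧ ConcaveOn ℝ (Set.Ici zt) σ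

/-- The dot product `wᵀx`. -/
def dotp {n : ℕ} (w x : Fin n → ℝ) : ℝ := ∑ i, w i * x i

/-- The region `R_f` of `[0,1]^n`. Note `‖x‖` is the sup norm on `Fin n → ℝ`. -/
def Rf {n : ℕ} (w : Fin n → ℝ) (b zhat : ℝ) : Set (Fin n → ℝ) :=
  {x | x ∈ Set.Icc (0 : Fin n → ℝ) 1 ∧ zhat ≤ dotp w x + b}

/-- The region `R_l` of `[0,1]^n`. -/
def Rl {n : ℕ} (w : Fin n → ℝ) (b zhat : ℝ) : Set (Fin n → ℝ) :=
  {x | x ∈ Set.Icc (0 : Fin n → ℝ) 1 ∧ dotp w x + b < zhat ∧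
    zhat * ‖x‖ ≤ dotp w x + b * ‖x‖}

/-- The region `R_i` of `[0,1]^n`. -/
def Ri {n : ℕ} (w : Fin n → ℝ) (b zhat : ℝ) (i : Fin n) : Set (Fin n → ℝ) :=
  {x | x ∈ Set.Icc (0 : Fin n → ℝ) 1 ∧ dotp w x + b * ‖x‖ < zhat * ‖x‖ ∧
    (∀ j, j < i → x j < x i) ∧ (∀ j, i ≤ j → x j ≤ x i)}

/-- `D'` is a face of the convex set `D`. -/
def IsFace {E : Type*} [AddCommGroup E] [Module ℝ E] (D D' : Set E) : Prop :=
  D' ⊆ D ∧ Convex ℝ D' ∧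
    ∀ x ∈ D, ∀ y ∈ D, ∀ t : ℝ, 0 < t → t < 1 →
      (1 - t) • x + t • y ∈ D' → x ∈ D' ∧ y ∈ D'


open Set Filter Topology

theorem IsConcaveEnvelope.congr {E : Type*} [AddCommMonoid E] [Module ℝ E] {S : Set E}
    {f φ g : E → ℝ} (hφ : IsConcaveEnvelope S f φ) (hg : ∀ x ∈ S, g x = φ x) :
    IsConcaveEnvelope S f g := by
  refine ⟨hφ.1.congr fun x hx => (hg x hx).symm, fun x hx => ?_, fun h hh hfh x hx => ?_⟩
  · rw [hg x hx]; exact hφ.2.1 x hx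
  · rw [hg x hx]; exact hφ.2.2 h hh hfh x hx

theorem ConcaveOn.isConcaveEnvelope_self {E : Type*} [AddCommMonoid E] [Module ℝ E] {S : Set E}
    {f : E → ℝ} (hf : ConcaveOn ℝ S f) : IsConcaveEnvelope S f f :=
  ⟨hf, fun _ _ => le_rfl, fun _ _ hfh => hfh⟩

/-- Up to the witness, slopes from the left endpoint are at most the slope at the witness. -/
theorem STFEwitness.slope_le {σ : ℝ → ℝ} {b v z : ℝ} (hb : σ b = 0) (h : STFEwitness σ b v z)
    {t : ℝ} (hbt : b < t) (htz : t ≤ z) : σ t / (t - b) ≤ σ z / (z - b) := by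
  rcases htz.eq_or_lt with rfl | htz
  · rfl
  have := h.2.2.1 t ⟨hbt.le, htz.le.trans h.1.2⟩
  simp only [htz, if_true, hb, zero_add, sub_zero] at this
  rwa [div_le_iff₀ (by linarith)]

/-- Past the witness, slopes from the left endpoint decrease. -/
theorem STFEwitness.slope_anti {σ : ℝ → ℝ} {b v z : ℝ} (hb : σ b = 0) (h : STFEwitness σ b v z)
    {t s : ℝ} (hbt : b < t) (hzt : z ≤ t) (hts : t ≤ s) (hsv : s ≤ v) :
    σ s / (s - b) ≤ σ t / (t - b) := by
  have hbs : 0 < s - b := by linarith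
  have := h.2.1.2 (⟨le_rfl, by linarith⟩ : b ∈ Icc b v) (⟨by linarith, hsv⟩ : s ∈ Icc b v)
    (div_nonneg (by linarith) hbs.le : 0 ≤ (s - t) / (s - b))
    (div_nonneg (by linarith) hbs.le : 0 ≤ (t - b) / (s - b))
    (by field_simp; ring)
  have e : (s - t) / (s - b) * b + (t - b) / (s - b) * s = t := by field_simp; ring
  simp only [smul_eq_mul, e, hzt.not_gt, (hzt.trans hts).not_gt, if_false, hb, sub_self,
    mul_zero, add_zero, ite_self, zero_add] at this
  rw [le_div_iff₀ (by linarith)]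
  calc σ s / (s - b) * (t - b) = (t - b) / (s - b) * σ s := by ring
    _ ≤ σ t := this

/-- Below the witness, slopes from the left endpoint are monotone. -/
theorem STFE.slope_mono {σ : ℝ → ℝ} (hσ : Continuous σ) (hS : STFE σ) {b u zhat : ℝ}
    (hb : σ b = 0) (hz : STFEwitness σ b u zhat) {t s : ℝ} (hbt : b < t) (hts : t ≤ s)
    (hsz : s ≤ zhat) : σ t / (t - b) ≤ σ s / (s - b) := by
  by_contra! hlt
  have hrc : ∀ y, ContinuousOn (fun x => σ x / (x - b)) (Icc s y) := fun y =>
    hσ.continuousOn.div (by fun_prop) fun x hx => by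
      have := hx.1; exact (by linarith : 0 < x - b).ne'
  have htz := hz.slope_le hb hbt (hts.trans hsz)
  obtain ⟨q, hsq, hqt⟩ := exists_between hlt
  obtain ⟨v, ⟨hv, hvq⟩, hleast⟩ :
      ∃ v, IsLeast {x | x ∈ Icc s zhat ∧ σ x / (x - b) = q} v := by
    refine IsCompact.exists_isLeast ?_ ?_
    · exact isCompact_Icc.of_isClosed_subset
        ((hrc zhat).preimage_isClosed_of_isClosed isClosed_Icc isClosed_singleton)
        fun x hx => hx.1
    · obtain ⟨x, hx, hxq⟩ := intermediate_value_Icc hsz (hrc zhat) ⟨hsq.le, hqt.le.trans htz⟩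
      exact ⟨x, hx, hxq⟩
  obtain ⟨z, hw⟩ := hS b v (by linarith [hv.1])
  rcases le_or_gt z s with hzs | hsz'
  · have := hw.slope_anti hb (hbt.trans_le hts) hzs hv.1 le_rfl
    linarith
  · have htz' := hw.slope_le hb hbt (hts.trans hsz'.le)
    obtain ⟨x, hx, hxq⟩ := intermediate_value_Icc hsz'.le (hrc z) ⟨hsq.le, hqt.le.trans htz'⟩
    have := hleast ⟨⟨hx.1, hx.2.trans (hw.1.2.trans hv.2)⟩, hxq⟩
    have hzv : z = v := le_antisymm hw.1.2 (this.trans hx.2)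
    rw [hzv] at htz'
    linarith

/-- A concave majorant of `σ ∘ s` on the part `s < zhat` of `C` extends concavely to `C` by
`σ ∘ s`, after being cut off by `Φ ∘ s`, where `Φ` is a concave majorant of `σ` that agrees with
`σ` from `zhat` on. -/
theorem concaveOn_glue {E : Type*} [AddCommGroup E] [Module ℝ E] {C : Set E} (hC : Convex ℝ C)
    {s : E → ℝ} (hs : ∀ x y : E, ∀ a c : ℝ, a + c = 1 → s (a • x + c • y) = a * s x + c * s y)
    {I : Set ℝ} (hsI : ∀ x ∈ C, s x ∈ I) {σ Φ : ℝ → ℝ} (hσ : Continuous σ)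
    (hΦ : ConcaveOn ℝ I Φ) (hσΦ : ∀ z ∈ I, σ z ≤ Φ z) {zhat : ℝ}
    (hΦσ : ∀ z ∈ I, zhat ≤ z → Φ z = σ z) {h : E → ℝ}
    (hh : ConcaveOn ℝ {x | x ∈ C ∧ s x < zhat} h)
    (hfh : ∀ x ∈ C, s x < zhat → σ (s x) ≤ h x) :
    ConcaveOn ℝ C (fun x => if s x < zhat then min (h x) (Φ (s x)) else σ (s x)) := by
  set G : E → ℝ := fun x => if s x < zhat then min (h x) (Φ (s x)) else σ (s x) with hG
  have hGΦ : ∀ x ∈ C, G x ≤ Φ (s x) := fun x hx => by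
    simp only [hG]; split_ifs
    · exact min_le_right _ _
    · exact hσΦ _ (hsI x hx)
  have hfG : ∀ x ∈ C, σ (s x) ≤ G x := fun x hx => by
    simp only [hG]; split_ifs with hlt
    · exact le_min (hfh x hx hlt) (hσΦ _ (hsI x hx))
    · exact le_rfl
  have hΦG : ∀ x ∈ C, zhat ≤ s x → G x = Φ (s x) := fun x hx hz => by
    simp only [hG, hz.not_gt, if_false]; exact (hΦσ _ (hsI x hx) hz).symm
  have hΦm : ∀ x ∈ C, ∀ y ∈ C, ∀ a c : ℝ, 0 ≤ a → 0 ≤ c → a + c = 1 →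
      a * G x + c * G y ≤ Φ (s (a • x + c • y)) := fun x hx y hy a c ha hc hac => by
    rw [hs x y a c hac]
    have := hΦ.2 (hsI x hx) (hsI y hy) ha hc hac
    simp only [smul_eq_mul] at this
    have h1 := mul_le_mul_of_nonneg_left (hGΦ x hx) ha
    have h2 := mul_le_mul_of_nonneg_left (hGΦ y hy) hc
    linarith
  have hleft : ∀ x ∈ C, s x < zhat → ∀ y ∈ C, s y < zhat → ∀ a c : ℝ, 0 ≤ a → 0 ≤ c →
      a + c = 1 → a * G x + c * G y ≤ G (a • x + c • y) := fun x hx hxz y hy hyz a c ha hc hac => by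
    have hm := hh.1 ⟨hx, hxz⟩ ⟨hy, hyz⟩ ha hc hac
    have h1 := hh.2 ⟨hx, hxz⟩ ⟨hy, hyz⟩ ha hc hac
    have h2 := hΦm x hx y hy a c ha hc hac
    have hGm : G (a • x + c • y) = min (h (a • x + c • y)) (Φ (s (a • x + c • y))) := by
      simp only [hG, hm.2, if_true]
    rw [hGm]
    refine le_min (le_trans ?_ h1) h2
    simp only [smul_eq_mul]
    have hx' : G x ≤ h x := by simp only [hG, hxz, if_true]; exact min_le_left _ _
    have hy' : G y ≤ h y := by simp only [hG, hyz, if_true]; exact min_le_left _ _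
    gcongr
  have hcross : ∀ x ∈ C, s x < zhat → ∀ y ∈ C, zhat ≤ s y → ∀ a c : ℝ, 0 ≤ a → 0 ≤ c →
      a + c = 1 → s (a • x + c • y) < zhat → a * G x + c * G y ≤ G (a • x + c • y) := by
    intro x hx hxz y hy hyz a c ha hc hac hm
    rw [hs x y a c hac] at hm
    have hd : 0 < s y - s x := by linarith
    set T := (zhat - s x) / (s y - s x) with hT
    have hTd : T * (s y - s x) = zhat - s x := by rw [hT]; field_simp
    have hcT : c < T := by
      rw [hT, lt_div_iff₀ hd]
      obtain rfl : a = 1 - c := by linarith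
      linarith
    have hT1 : T ≤ 1 := by rw [hT, div_le_one hd]; linarith
    have hT0 : 0 < T := hc.trans_lt hcT
    have hev : ∀ τ ∈ Ioo c T,
        (1 - c / τ) * G x + c / τ * σ ((1 - τ) * s x + τ * s y) ≤ G (a • x + c • y) := by
      rintro τ ⟨h1, h2⟩
      have hτ : 0 < τ := hc.trans_lt h1
      have hp : (1 - τ) • x + τ • y ∈ C := hC hx hy (by linarith) hτ.le (by ring)
      have hsp : s ((1 - τ) • x + τ • y) = (1 - τ) * s x + τ * s y := hs _ _ _ _ (by ring)
      have hpz : s ((1 - τ) • x + τ • y) < zhat := by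
        rw [hsp]; nlinarith
      have hct : c / τ ≤ 1 := by rw [div_le_one hτ]; exact h1.le
      have key := hleft x hx hxz _ hp hpz (1 - c / τ) (c / τ) (by linarith) (by positivity) (by ring)
      have e : (1 - c / τ) • x + (c / τ) • ((1 - τ) • x + τ • y) = a • x + c • y := by
        obtain rfl : a = 1 - c := by linarith
        rw [smul_add, smul_smul, smul_smul, ← add_assoc, ← add_smul]
        congr 2 <;> field_simp
        ring
      rw [e] at key
      refine le_trans ?_ key
      rw [← hsp]
      gcongr
      exact hfG _ hp
    have hlim : Tendsto (fun τ => (1 - c / τ) * G x + c / τ * σ ((1 - τ) * s x + τ * s y))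
        (𝓝[<] T) (𝓝 ((1 - c / T) * G x + c / T * σ ((1 - T) * s x + T * s y))) := by
      refine ContinuousAt.continuousWithinAt (f := fun τ => (1 - c / τ) * G x +
        c / τ * σ ((1 - τ) * s x + τ * s y)) ?_
      have : ContinuousAt (fun τ : ℝ => c / τ) T := continuousAt_const.div continuousAt_id hT0.ne'
      have h2 : ContinuousAt (fun τ : ℝ => σ ((1 - τ) * s x + τ * s y)) T := by fun_prop
      exact ((continuousAt_const.sub this).mul continuousAt_const).add (this.mul h2)
    have hle := le_of_tendsto hlim
      (Filter.mem_of_superset (Ioo_mem_nhdsLT hcT) hev)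
    have hpC : (1 - T) • x + T • y ∈ C := hC hx hy (by linarith) hT0.le (by ring)
    have hsp : s ((1 - T) • x + T • y) = (1 - T) * s x + T * s y := hs _ _ _ _ (by ring)
    have hspz : (1 - T) * s x + T * s y = zhat := by linarith
    have hc' := hΦm x hx y hy (1 - T) T (by linarith) hT0.le (by ring)
    rw [hsp, hΦσ _ (hsp ▸ hsI _ hpC) hspz.ge] at hc'
    have := mul_le_mul_of_nonneg_left hc' (div_nonneg hc hT0.le : 0 ≤ c / T)
    refine le_trans ?_ hle
    obtain rfl : a = 1 - c := by linarith
    have e : c / T * ((1 - T) * G x + T * G y) = c / T * G x - c * G x + c * G y := by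
      field_simp
    linarith
  refine ⟨hC, fun x hx y hy a c ha hc hac => ?_⟩
  simp only [smul_eq_mul]
  have hmC := hC hx hy ha hc hac
  by_cases hm : s (a • x + c • y) < zhat
  · by_cases hxz : s x < zhat
    · by_cases hyz : s y < zhat
      · exact hleft x hx hxz y hy hyz a c ha hc hac
      · exact hcross x hx hxz y hy (not_lt.1 hyz) a c ha hc hac hm
    · by_cases hyz : s y < zhat
      · rw [add_comm (a • x)] at hm ⊢
        rw [add_comm (a * G x)]
        exact hcross y hy hyz x hx (not_lt.1 hxz) c a hc ha (by linarith) hm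
      · exfalso
        rw [hs x y a c hac] at hm
        obtain rfl : a = 1 - c := by linarith
        nlinarith
  · rw [hΦG _ hmC (not_lt.1 hm)]
    exact hΦm x hx y hy a c ha hc hac

/-- Below `zhat`, the concave envelope of `σ ∘ s` over `C` is at most every concave majorant
given only there. -/
theorem IsConcaveEnvelope.le_of_concaveOn_lt {E : Type*} [AddCommGroup E] [Module ℝ E] {C : Set E}
    {s : E → ℝ} (hs : ∀ x y : E, ∀ a c : ℝ, a + c = 1 → s (a • x + c • y) = a * s x + c * s y)
    {I : Set ℝ} (hsI : ∀ x ∈ C, s x ∈ I) {σ Φ : ℝ → ℝ} (hσ : Continuous σ)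
    (hΦ : ConcaveOn ℝ I Φ) (hσΦ : ∀ z ∈ I, σ z ≤ Φ z) {zhat : ℝ}
    (hΦσ : ∀ z ∈ I, zhat ≤ z → Φ z = σ z) {ψ : E → ℝ}
    (hψ : IsConcaveEnvelope C (fun x => σ (s x)) ψ) {h : E → ℝ}
    (hh : ConcaveOn ℝ {x | x ∈ C ∧ s x < zhat} h)
    (hfh : ∀ x ∈ C, s x < zhat → σ (s x) ≤ h x) {x : E} (hx : x ∈ C) (hxz : s x < zhat) :
    ψ x ≤ h x := by
  have := hψ.2.2 _ (concaveOn_glue hψ.1.1 hs hsI hσ hΦ hσΦ hΦσ hh hfh) (fun y hy => ?_) x hx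
  · simp only [hxz, if_true] at this
    exact this.trans (min_le_left _ _)
  · dsimp only; split_ifs with hlt
    · exact le_min (hfh y hy hlt) (hσΦ _ (hsI y hy))
    · exact le_rfl

/-- The slice estimate: a concave majorant of `σ ∘ s` that is only given on the part `s < zhat`
of the cube with the coordinates in `J` below `1` still dominates the concave envelope of `σ ∘ s`
over the whole cube. -/
theorem IsConcaveEnvelope.le_of_concaveOn_cube {ι : Type*} [Fintype ι] {v : ι → ℝ}
    (hv : ∀ j, 0 ≤ v j) (c : ℝ) {l u : ℝ}
    (hlu : ∀ y ∈ Icc (0 : ι → ℝ) 1, ∑ j, v j * y j + c ∈ Icc l u)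
    {σ Φ : ℝ → ℝ} (hσ : Continuous σ) (hΦ : ConcaveOn ℝ (Icc l u) Φ)
    (hσΦ : ∀ z ∈ Icc l u, σ z ≤ Φ z) {zhat : ℝ} (hΦσ : ∀ z ∈ Icc l u, zhat ≤ z → Φ z = σ z)
    {ψ : (ι → ℝ) → ℝ}
    (hψ : IsConcaveEnvelope (Icc 0 1) (fun y : ι → ℝ => σ (∑ j, v j * y j + c)) ψ)
    (J : Set ι) {k : (ι → ℝ) → ℝ}
    (hk : ConcaveOn ℝ {y | y ∈ Icc (0 : ι → ℝ) 1 ∧ ∑ j, v j * y j + c < zhat ∧ ∀ j ∈ J, y j < 1} k)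
    (hfk : ∀ y ∈ Icc (0 : ι → ℝ) 1, ∑ j, v j * y j + c < zhat → (∀ j ∈ J, y j < 1) →
      σ (∑ j, v j * y j + c) ≤ k y)
    {y : ι → ℝ} (hy : y ∈ Icc (0 : ι → ℝ) 1) (hyz : ∑ j, v j * y j + c < zhat)
    (hyJ : ∀ j ∈ J, y j < 1) : ψ y ≤ k y := by
  classical
  set s : (ι → ℝ) → ℝ := fun y => ∑ j, v j * y j + c with hs_def
  have hs : ∀ x y : ι → ℝ, ∀ a c : ℝ, a + c = 1 → s (a • x + c • y) = a * s x + c * s y := by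
    intro x y a d had
    have : ∑ j, v j * (a • x + d • y) j = a * ∑ j, v j * x j + d * ∑ j, v j * y j := by
      rw [Finset.mul_sum, Finset.mul_sum, ← Finset.sum_add_distrib]
      refine Finset.sum_congr rfl fun j _ => ?_
      simp only [Pi.add_apply, Pi.smul_apply, smul_eq_mul]; ring
    simp only [hs_def, this]
    linear_combination (-c) * had
  set μ : ι → ℝ := fun j => if j ∈ J then 1 else 0 with hμ
  have hμ0 : ∀ j, 0 ≤ μ j := fun j => by simp only [hμ]; split_ifs <;> norm_num
  have hμ1 : ∀ j, μ j ≤ 1 := fun j => by simp only [hμ]; split_ifs <;> norm_num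
  set P : ℝ → (ι → ℝ) → ι → ℝ := fun θ y j => (1 + θ * μ j) * y j with hP
  have hPlin : ∀ θ x y (a d : ℝ), P θ (a • x + d • y) = a • P θ x + d • P θ y := by
    intro θ x y a d
    ext j
    simp only [hP, Pi.add_apply, Pi.smul_apply, smul_eq_mul]; ring
  have hPmem : ∀ ε : ℝ, 0 < ε → ε < 1 → ∀ y ∈ Icc (0 : ι → ℝ) 1, s y < zhat →
      P (-ε) y ∈ {y | y ∈ Icc (0 : ι → ℝ) 1 ∧ s y < zhat ∧ ∀ j ∈ J, y j < 1} := by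
    intro ε h0 h1 y hy hyz
    have hf0 : ∀ j, 0 ≤ 1 + -ε * μ j := fun j => by nlinarith [hμ0 j, hμ1 j]
    have hle : ∀ j, P (-ε) y j ≤ y j := fun j => by
      have := mul_nonneg (mul_nonneg h0.le (hμ0 j)) (hy.1 j)
      simp only [hP]; linarith
    refine ⟨⟨fun j => mul_nonneg (hf0 j) (hy.1 j), fun j => (hle j).trans (hy.2 j)⟩,
      lt_of_le_of_lt ?_ hyz, fun j hj => ?_⟩
    · simp only [hs_def]
      gcongr with j
      · exact hv j
      · exact hle j
    · have h2 : y j ≤ 1 := hy.2 j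
      have h3 : 0 ≤ y j := hy.1 j
      simp only [hP, hμ, hj, if_true]
      nlinarith
  -- a point beyond `y`, away from the origin in the directions of `J`
  obtain ⟨η, hη0, hηJ, hηz⟩ : ∃ η : ℝ, 0 < η ∧ (∀ j ∈ J, P η y j < 1) ∧ s (P η y) < zhat := by
    have e0 : P 0 y = y := by ext j; simp [hP]
    have hPc : Continuous fun θ => P θ y := by simp only [hP]; fun_prop
    have h1 : ∀ᶠ θ in 𝓝 (0 : ℝ), ∀ j, j ∈ J → P θ y j < 1 := by
      refine Filter.eventually_all.2 fun j => ?_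
      by_cases hj : j ∈ J
      · have : ContinuousAt (fun θ => P θ y j) 0 := by fun_prop
        have h := this.eventually_lt (continuousAt_const (y := (1 : ℝ)))
          (by rw [e0]; exact hyJ j hj)
        exact h.mono fun _ h _ => h
      · exact Filter.Eventually.of_forall fun _ h => absurd h hj
    have h2 : ∀ᶠ θ in 𝓝 (0 : ℝ), s (P θ y) < zhat := by
      have : ContinuousAt (fun θ => s (P θ y)) 0 := by simp only [hs_def, hP]; fun_prop
      exact this.eventually_lt continuousAt_const (by rw [e0]; exact hyz)
    obtain ⟨η, ⟨ha, hb⟩, hc⟩ := (((h1.and h2).filter_mono nhdsWithin_le_nhds).and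
      (self_mem_nhdsWithin (s := Ioi (0 : ℝ)))).exists
    exact ⟨η, hc, ha, hb⟩
  have hηmem : P η y ∈ {y | y ∈ Icc (0 : ι → ℝ) 1 ∧ s y < zhat ∧ ∀ j ∈ J, y j < 1} := by
    refine ⟨⟨fun j => mul_nonneg (by nlinarith [hμ0 j]) (hy.1 j), fun j => ?_⟩, hηz, hηJ⟩
    by_cases hj : j ∈ J
    · exact (hηJ j hj).le
    · simp only [hP, hμ, hj, if_false, mul_zero, add_zero, one_mul]; exact hy.2 j
  refine le_of_forall_pos_le_add fun δ hδ => ?_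
  have hunif : ∃ ε₀ > 0, ∀ ε, 0 < ε → ε < ε₀ → ε < 1 → ∀ y ∈ Icc (0 : ι → ℝ) 1, s y < zhat →
      σ (s y) ≤ σ (s (P (-ε) y)) + δ := by
    obtain ⟨d, hd, hdσ⟩ := Metric.uniformContinuousOn_iff.1
      (isCompact_Icc.uniformContinuousOn_of_continuous (hσ.continuousOn (s := Icc l u))) δ hδ
    have hV : 0 ≤ ∑ j, v j := Finset.sum_nonneg fun j _ => hv j
    refine ⟨d / (∑ j, v j + 1), by positivity, fun ε h0 hε h1 y hy hyz => ?_⟩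
    have hdist : |s y - s (P (-ε) y)| < d := by
      have e : s y - s (P (-ε) y) = ∑ j, v j * (ε * μ j * y j) := by
        simp only [hs_def, hP, add_sub_add_right_eq_sub, ← Finset.sum_sub_distrib]
        exact Finset.sum_congr rfl fun j _ => by ring
      have hle : ∑ j, v j * (ε * μ j * y j) ≤ ε * ∑ j, v j := by
        rw [Finset.mul_sum]
        refine Finset.sum_le_sum fun j _ => ?_
        have : μ j * y j ≤ 1 := mul_le_one₀ (hμ1 j) (hy.1 j) (hy.2 j)
        have := mul_le_mul_of_nonneg_left this (mul_nonneg h0.le (hv j))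
        linarith
      rw [e, abs_of_nonneg (Finset.sum_nonneg fun j _ =>
        mul_nonneg (hv j) (mul_nonneg (mul_nonneg h0.le (hμ0 j)) (hy.1 j)))]
      rw [lt_div_iff₀ (by positivity)] at hε
      linarith
    have := hdσ _ (hlu y hy) _ (hlu _ (hPmem ε h0 h1 y hy hyz).1) hdist
    rw [Real.dist_eq] at this
    linarith [(abs_lt.1 this).2]
  obtain ⟨ε₀, hε₀, hunif⟩ := hunif
  have hbound : ∀ ε ∈ Ioo 0 (min ε₀ 1),
      (1 - ε / (η + ε)) * (ψ y - δ) + ε / (η + ε) * k (P η y) ≤ k y := by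
    rintro ε ⟨h0, hε⟩
    have h1 : ε < 1 := hε.trans_le (min_le_right _ _)
    have hψk : ψ y ≤ k (P (-ε) y) + δ := by
      refine hψ.le_of_concaveOn_lt (h := fun y => k (P (-ε) y) + δ) hs hlu hσ hΦ hσΦ hΦσ ?_ ?_ hy hyz
      · refine ⟨?_, fun x hx z hz a d ha hd had => ?_⟩
        · intro x hx z hz a d ha hd had
          refine ⟨hψ.1.1 hx.1 hz.1 ha hd had, ?_⟩
          rw [hs x z a d had]
          have := (convex_Iio zhat) hx.2 hz.2 ha hd had
          simpa using this
        · have := hk.2 (hPmem ε h0 h1 x hx.1 hx.2) (hPmem ε h0 h1 z hz.1 hz.2) ha hd had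
          simp only [smul_eq_mul] at this ⊢
          rw [hPlin]
          calc a * (k (P (-ε) x) + δ) + d * (k (P (-ε) z) + δ)
              = a * k (P (-ε) x) + d * k (P (-ε) z) + (a + d) * δ := by ring
            _ ≤ _ := by rw [had]; linarith
      · intro x hx hxz
        have hm := hPmem ε h0 h1 x hx hxz
        have h2 := hfk _ hm.1 hm.2.1 hm.2.2
        have h3 := hunif ε h0 (hε.trans_le (min_le_left _ _)) h1 x hx hxz
        linarith
    have hne : 0 < η + ε := by linarith
    have ht1 : 0 ≤ 1 - ε / (η + ε) := by
      rw [sub_nonneg, div_le_one hne]; linarith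
    have key := hk.2 (hPmem ε h0 h1 y hy hyz) hηmem ht1
      (by positivity : 0 ≤ ε / (η + ε)) (by ring)
    have e : (1 - ε / (η + ε)) • P (-ε) y + (ε / (η + ε)) • P η y = y := by
      ext j
      simp only [hP, Pi.add_apply, Pi.smul_apply, smul_eq_mul]
      field_simp
      ring
    rw [e] at key
    simp only [smul_eq_mul] at key
    refine le_trans ?_ key
    gcongr
    linarith
  have hlim : Tendsto (fun ε => (1 - ε / (η + ε)) * (ψ y - δ) + ε / (η + ε) * k (P η y))
      (𝓝[>] 0) (𝓝 ((1 - 0 / (η + 0)) * (ψ y - δ) + 0 / (η + 0) * k (P η y))) := by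
    refine ContinuousAt.continuousWithinAt
      (f := fun ε => (1 - ε / (η + ε)) * (ψ y - δ) + ε / (η + ε) * k (P η y)) ?_
    have : ContinuousAt (fun ε : ℝ => ε / (η + ε)) 0 :=
      continuousAt_id.div (by fun_prop) (by simpa using hη0.ne')
    exact ((continuousAt_const.sub this).mul continuousAt_const).add (this.mul continuousAt_const)
  have := le_of_tendsto hlim
    (Filter.mem_of_superset (Ioo_mem_nhdsGT (lt_min hε₀ one_pos)) hbound)
  simp only [zero_div, sub_zero, one_mul, zero_mul, add_zero] at this
  linarith

theorem dotp_comb {n : ℕ} (w x y : Fin n → ℝ) (a c : ℝ) :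
    dotp w (a • x + c • y) = a * dotp w x + c * dotp w y := by
  simp only [dotp, Finset.mul_sum, ← Finset.sum_add_distrib]
  refine Finset.sum_congr rfl fun j _ => ?_
  simp only [Pi.add_apply, Pi.smul_apply, smul_eq_mul]; ring

theorem dotp_smul {n : ℕ} (w x : Fin n → ℝ) (a : ℝ) : dotp w (a • x) = a * dotp w x := by
  simpa [dotp] using dotp_comb w x x a 0

theorem dotp_mem_Icc {n : ℕ} {w x : Fin n → ℝ} (hw : ∀ i, 0 ≤ w i)
    (hx : x ∈ Icc (0 : Fin n → ℝ) 1) : dotp w x ∈ Icc 0 (∑ i, w i) := by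
  refine ⟨Finset.sum_nonneg fun i _ => mul_nonneg (hw i) (hx.1 i), ?_⟩
  exact Finset.sum_le_sum fun i _ => mul_le_of_le_one_right (hw i) (hx.2 i)

theorem smul_mem_Icc_of_norm_le {n : ℕ} {x : Fin n → ℝ} (hx : 0 ≤ x) {a : ℝ} (ha : 0 ≤ a)
    (h : a * ‖x‖ ≤ 1) : a • x ∈ Icc (0 : Fin n → ℝ) 1 := by
  refine ⟨fun i => mul_nonneg ha (hx i), fun i => ?_⟩
  refine le_trans ?_ h
  have : x i ≤ ‖x‖ := (le_abs_self _).trans (norm_le_pi_norm x i)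
  simpa using mul_le_mul_of_nonneg_left this ha

theorem norm_eq_of_le {n : ℕ} {x : Fin n → ℝ} (hx : 0 ≤ x) {i : Fin n} (h : ∀ j, x j ≤ x i) :
    ‖x‖ = x i := by
  refine le_antisymm ((pi_norm_le_iff_of_nonneg (hx i)).2 fun j => ?_) ?_
  · rw [Real.norm_eq_abs, abs_of_nonneg (hx j)]; exact h j
  · exact (le_abs_self _).trans (norm_le_pi_norm x i)

theorem mem_Ri_iff {n : ℕ} {w : Fin n → ℝ} {b zhat : ℝ} {i : Fin n} {x : Fin n → ℝ} :
    x ∈ Ri w b zhat i ↔ x ∈ Icc (0 : Fin n → ℝ) 1 ∧ dotp w x + b * x i < zhat * x i ∧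
      (∀ j, j < i → x j < x i) ∧ ∀ j, x j ≤ x i := by
  constructor
  · rintro ⟨hx, h, h1, h2⟩
    have h3 : ∀ j, x j ≤ x i := fun j => (lt_or_ge j i).elim (fun hj => (h1 j hj).le) (h2 j)
    rw [norm_eq_of_le hx.1 h3] at h
    exact ⟨hx, h, h1, h3⟩
  · rintro ⟨hx, h, h1, h2⟩
    rw [← norm_eq_of_le hx.1 h2] at h
    exact ⟨hx, h, h1, fun j _ => h2 j⟩

theorem convex_Ri {n : ℕ} (w : Fin n → ℝ) (b zhat : ℝ) (i : Fin n) :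
    Convex ℝ (Ri w b zhat i) := by
  intro x hx y hy a c ha hc hac
  rw [mem_Ri_iff] at hx hy ⊢
  refine ⟨convex_Icc _ _ hx.1 hy.1 ha hc hac, ?_, fun j hj => ?_, fun j => ?_⟩
  · have := (convex_Iio (𝕜 := ℝ) 0) (sub_neg.2 hx.2.1) (sub_neg.2 hy.2.1) ha hc hac
    simp only [mem_Iio, smul_eq_mul] at this
    rw [dotp_comb]
    simp only [Pi.add_apply, Pi.smul_apply, smul_eq_mul]
    linarith
  · have := (convex_Iio (𝕜 := ℝ) 0) (sub_neg.2 (hx.2.2.1 j hj)) (sub_neg.2 (hy.2.2.1 j hj)) ha hc hac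
    simp only [mem_Iio, smul_eq_mul] at this
    simp only [Pi.add_apply, Pi.smul_apply, smul_eq_mul]
    linarith
  · have h1 := mul_le_mul_of_nonneg_left (hx.2.2.2 j) ha
    have h2 := mul_le_mul_of_nonneg_left (hy.2.2.2 j) hc
    simp only [Pi.add_apply, Pi.smul_apply, smul_eq_mul]
    linarith

theorem convex_Rl {n : ℕ} (w : Fin n → ℝ) {b zhat : ℝ} (hz : b ≤ zhat) :
    Convex ℝ (Rl w b zhat) := by
  rintro x ⟨hx, hx1, hx2⟩ y ⟨hy, hy1, hy2⟩ a c ha hc hac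
  refine ⟨convex_Icc _ _ hx hy ha hc hac, ?_, ?_⟩
  · have := (convex_Iio (𝕜 := ℝ) zhat) hx1 hy1 ha hc hac
    simp only [mem_Iio, smul_eq_mul] at this
    rw [dotp_comb]
    obtain rfl : a = 1 - c := by linarith
    linarith
  · rw [dotp_comb]
    have h1 := mul_le_mul_of_nonneg_left hx2 ha
    have h2 := mul_le_mul_of_nonneg_left hy2 hc
    have h3 : ‖a • x + c • y‖ ≤ a * ‖x‖ + c * ‖y‖ := by
      refine (norm_add_le _ _).trans ?_
      rw [norm_smul, norm_smul, Real.norm_of_nonneg ha, Real.norm_of_nonneg hc]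
    have h4 := mul_le_mul_of_nonneg_left h3 (sub_nonneg.2 hz)
    linarith

theorem isConcaveEnvelope_Rf {n : ℕ} {w : Fin n → ℝ} (hw : ∀ i, 0 ≤ w i) {b zhat : ℝ}
    {σ : ℝ → ℝ} (hz : STFEwitness σ b ((∑ i, w i) + b) zhat) :
    IsConcaveEnvelope (Rf w b zhat) (fun x => σ (dotp w x + b)) (fun x => σ (dotp w x + b)) := by
  refine ConcaveOn.isConcaveEnvelope_self ?_
  have haff : ∀ (x y : Fin n → ℝ) (a c : ℝ), a + c = 1 →
      dotp w (a • x + c • y) + b = a * (dotp w x + b) + c * (dotp w y + b) := by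
    intro x y a c hac
    rw [dotp_comb]
    linear_combination (-b) * hac
  have hconv : Convex ℝ (Rf w b zhat) := by
    rintro x ⟨hx, hx1⟩ y ⟨hy, hy1⟩ a c ha hc hac
    refine ⟨convex_Icc _ _ hx hy ha hc hac, ?_⟩
    rw [haff x y a c hac]
    exact (convex_Ici (𝕜 := ℝ) zhat) hx1 hy1 ha hc hac
  have hmem : ∀ x ∈ Rf w b zhat, dotp w x + b ∈ Icc b ((∑ i, w i) + b) := fun x hx => by
    have := dotp_mem_Icc hw hx.1
    exact ⟨by linarith [this.1], by linarith [this.2]⟩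
  refine ⟨hconv, fun x hx y hy a c ha hc hac => ?_⟩
  have := hz.2.1.2 (hmem x hx) (hmem y hy) ha hc hac
  have hm := hconv hx hy ha hc hac
  have hmz := hm.2
  rw [haff x y a c hac] at hmz
  dsimp only
  rw [haff x y a c hac]
  simpa only [smul_eq_mul, hx.2.not_gt, hy.2.not_gt, hmz.not_gt, if_false] using this

theorem isConcaveEnvelope_Rl {n : ℕ} {w : Fin n → ℝ} (hw : ∀ i, 0 ≤ w i) {b zhat : ℝ}
    {σ : ℝ → ℝ} (hσ : Continuous σ) (hb : σ b = 0)
    (hz : STFEwitness σ b ((∑ i, w i) + b) zhat) :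
    IsConcaveEnvelope (Rl w b zhat) (fun x => σ (dotp w x + b))
      (fun x => σ zhat / (zhat - b) * dotp w x) := by
  have hbz : b ≤ zhat := hz.1.1
  refine ⟨⟨convex_Rl w hbz, fun x _ y _ a c _ _ _ => ?_⟩, fun x hx => ?_, fun h hh hfh x hx => ?_⟩
  · simp only [dotp_comb, smul_eq_mul]
    linarith
  · have h0 := (dotp_mem_Icc hw hx.1).1
    rcases h0.eq_or_lt with h0 | h0
    · simp only [← h0, zero_add, hb, mul_zero, le_refl]
    · have := hz.slope_le hb (by linarith : b < dotp w x + b) hx.2.1.le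
      rwa [add_sub_cancel_right, div_le_iff₀ h0] at this
  · have hlt : b < zhat := by linarith [(dotp_mem_Icc hw hx.1).1, hx.2.1]
    have h0mem : (0 : Fin n → ℝ) ∈ Rl w b zhat :=
      ⟨⟨le_rfl, zero_le_one⟩, by simpa [dotp] using hlt, by simp [dotp]⟩
    have h00 : 0 ≤ h 0 := by simpa [dotp, hb] using hfh 0 h0mem
    rcases (dotp_mem_Icc hw hx.1).1.eq_or_lt with h0 | h0
    · have := hfh x hx
      simp only [← h0, zero_add, hb] at this
      simpa [← h0] using this
    set T := (zhat - b) / dotp w x with hT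
    have hT1 : 1 < T := by rw [hT, one_lt_div h0]; linarith [hx.2.1]
    have hTx : T * ‖x‖ ≤ 1 := by
      rw [hT, div_mul_eq_mul_div, div_le_one h0]; linarith [hx.2.2]
    have hbd : ∀ t ∈ Ioo 1 T, 1 / t * σ (t * dotp w x + b) ≤ h x := by
      rintro t ⟨h1, h2⟩
      have ht0 : 0 < t := by linarith
      have hmem : t • x ∈ Rl w b zhat := by
        refine ⟨smul_mem_Icc_of_norm_le hx.1.1 ht0.le ?_, ?_, ?_⟩
        · exact (mul_le_mul_of_nonneg_right h2.le (norm_nonneg x)).trans hTx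
        · rw [dotp_smul]
          rw [hT, lt_div_iff₀ h0] at h2
          linarith
        · rw [dotp_smul, norm_smul, Real.norm_of_nonneg ht0.le]
          have := mul_le_mul_of_nonneg_left hx.2.2 ht0.le
          linarith
      have h1t : 1 / t ≤ 1 := by rw [div_le_one ht0]; exact h1.le
      have key := hh.2 hmem h0mem (by positivity : 0 ≤ 1 / t) (sub_nonneg.2 h1t) (by ring)
      have e : (1 / t) • t • x + (1 - 1 / t) • (0 : Fin n → ℝ) = x := by
        rw [smul_zero, add_zero, smul_smul, one_div_mul_cancel ht0.ne', one_smul]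
      rw [e] at key
      simp only [smul_eq_mul] at key
      have hf := hfh _ hmem
      simp only [dotp_smul] at hf
      have := mul_le_mul_of_nonneg_left hf (by positivity : 0 ≤ 1 / t)
      have := mul_nonneg (sub_nonneg.2 h1t) h00
      linarith
    have hlim : Tendsto (fun t => 1 / t * σ (t * dotp w x + b)) (𝓝[<] T)
        (𝓝 (1 / T * σ (T * dotp w x + b))) := by
      refine ContinuousAt.continuousWithinAt (f := fun t => 1 / t * σ (t * dotp w x + b)) ?_
      have : ContinuousAt (fun t : ℝ => 1 / t) T :=
        continuousAt_const.div continuousAt_id (by linarith : 0 < T).ne'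
      exact this.mul (by fun_prop)
    have := le_of_tendsto hlim (Filter.mem_of_superset (Ioo_mem_nhdsLT hT1) hbd)
    have e : T * dotp w x + b = zhat := by rw [hT]; field_simp; ring
    rw [e, hT] at this
    refine le_trans (le_of_eq ?_) this
    field_simp

/-- The lift of the slice `x i = 1` to the full cube. -/
def slice {n : ℕ} (i : Fin (n + 1)) (y : Fin n → ℝ) : Fin (n + 1) → ℝ :=
  Fin.insertNth (α := fun _ => ℝ) i 1 y

@[simp] theorem slice_self {n : ℕ} (i : Fin (n + 1)) (y : Fin n → ℝ) : slice i y i = 1 := by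
  simp [slice]

@[simp] theorem slice_succAbove {n : ℕ} (i : Fin (n + 1)) (y : Fin n → ℝ) (j : Fin n) :
    slice i y (i.succAbove j) = y j := by
  simp [slice]

theorem slice_comb {n : ℕ} (i : Fin (n + 1)) (x y : Fin n → ℝ) {a c : ℝ} (hac : a + c = 1) :
    slice i (a • x + c • y) = a • slice i x + c • slice i y := by
  ext j
  refine Fin.succAboveCases i ?_ (fun j => ?_) j <;> simp [hac]

theorem dotp_slice {n : ℕ} (w : Fin (n + 1) → ℝ) (i : Fin (n + 1)) (y : Fin n → ℝ) :
    dotp w (slice i y) = ∑ j, w (i.succAbove j) * y j + w i := by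
  simp [dotp, Fin.sum_univ_succAbove _ i, add_comm]

theorem slice_mem_Icc {n : ℕ} (i : Fin (n + 1)) {y : Fin n → ℝ}
    (hy : y ∈ Icc (0 : Fin n → ℝ) 1) : slice i y ∈ Icc (0 : Fin (n + 1) → ℝ) 1 := by
  refine ⟨fun j => ?_, fun j => ?_⟩
  · refine Fin.succAboveCases i ?_ (fun j => ?_) j
    · simp
    · simpa using hy.1 j
  · refine Fin.succAboveCases i ?_ (fun j => ?_) j
    · simp
    · simpa using hy.2 j

theorem slice_mem_Ri {n : ℕ} {w : Fin (n + 1) → ℝ} {b zhat : ℝ} {i : Fin (n + 1)} {y : Fin n → ℝ}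
    (hy : y ∈ Icc (0 : Fin n → ℝ) 1)
    (hz : ∑ j, w (i.succAbove j) * y j + (w i + b) < zhat)
    (hJ : ∀ j, i.succAbove j < i → y j < 1) : slice i y ∈ Ri w b zhat i := by
  refine mem_Ri_iff.2 ⟨slice_mem_Icc i hy, ?_, fun j => ?_, fun j => ?_⟩
  · rw [dotp_slice, slice_self]; linarith
  · refine Fin.succAboveCases i ?_ (fun j => ?_) j
    · simp
    · simpa using hJ j
  · rw [slice_self]; exact (slice_mem_Icc i hy).2 j

theorem Ri_pos {n : ℕ} {w : Fin n → ℝ} {b zhat : ℝ} {i : Fin n} {x : Fin n → ℝ}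
    (hx : x ∈ Ri w b zhat i) : 0 < x i := by
  rw [mem_Ri_iff] at hx
  refine (hx.1.1 i).lt_of_ne fun h0 => ?_
  have h0' : x i = 0 := h0.symm
  have : x = 0 := le_antisymm (fun j => (hx.2.2.2 j).trans_eq h0') hx.1.1
  have := hx.2.1
  simp_all [dotp]

theorem div_mem_slice {n : ℕ} {w : Fin (n + 1) → ℝ} {b zhat : ℝ} {i : Fin (n + 1)}
    {x : Fin (n + 1) → ℝ} (hx : x ∈ Ri w b zhat i) :
    (fun j => x (i.succAbove j) / x i) ∈ Icc (0 : Fin n → ℝ) 1 ∧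
      x i • slice i (fun j => x (i.succAbove j) / x i) = x := by
  have h0 := Ri_pos hx
  rw [mem_Ri_iff] at hx
  refine ⟨⟨fun j => div_nonneg (hx.1.1 _) h0.le, fun j => ?_⟩, ?_⟩
  · exact (div_le_one h0).2 (hx.2.2.2 _)
  · ext j
    refine Fin.succAboveCases i ?_ (fun j => ?_) j
    · simp
    · simp [mul_div_cancel₀ _ h0.ne']

theorem concaveOn_perspective_Ri {n : ℕ} {w : Fin (n + 1) → ℝ} {b zhat : ℝ} {i : Fin (n + 1)}
    {ψ : (Fin n → ℝ) → ℝ} (hψ : ConcaveOn ℝ (Icc 0 1) ψ) :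
    ConcaveOn ℝ (Ri w b zhat i) (fun x => x i * ψ (fun j => x (i.succAbove j) / x i)) := by
  refine ⟨convex_Ri w b zhat i, fun x hx y hy a c ha hc hac => ?_⟩
  have hz := Ri_pos (convex_Ri w b zhat i hx hy ha hc hac)
  have hx0 := Ri_pos hx
  have hy0 := Ri_pos hy
  simp only [Pi.add_apply, Pi.smul_apply, smul_eq_mul] at hz ⊢
  have key := hψ.2 (div_mem_slice hx).1 (div_mem_slice hy).1
    (div_nonneg (mul_nonneg ha hx0.le) hz.le) (div_nonneg (mul_nonneg hc hy0.le) hz.le)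
    (by rw [← add_div, div_self hz.ne'])
  have e : (a * x i / (a * x i + c * y i)) • (fun j => x (i.succAbove j) / x i) +
      (c * y i / (a * x i + c * y i)) • (fun j => y (i.succAbove j) / y i) =
      fun j => (a * x (i.succAbove j) + c * y (i.succAbove j)) / (a * x i + c * y i) := by
    ext j
    simp only [Pi.add_apply, Pi.smul_apply, smul_eq_mul]
    field_simp
  rw [e] at key
  have := mul_le_mul_of_nonneg_left key hz.le
  refine le_trans (le_of_eq ?_) this
  simp only [smul_eq_mul]
  field_simp

theorem isConcaveEnvelope_Ri {n : ℕ} {w : Fin (n + 1) → ℝ} (hw : ∀ i, 0 < w i) {b zhat : ℝ}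
    {σ : ℝ → ℝ} (hσ : Continuous σ) (hS : STFE σ) (hb : σ b = 0)
    (hz : STFEwitness σ b ((∑ i, w i) + b) zhat) (i : Fin (n + 1)) {ψ : (Fin n → ℝ) → ℝ}
    (hψ : IsConcaveEnvelope (Icc 0 1)
      (fun y : Fin n → ℝ => σ (∑ j, w (i.succAbove j) * y j + (w i + b))) ψ) :
    IsConcaveEnvelope (Ri w b zhat i) (fun x => σ (dotp w x + b))
      (fun x => x i * ψ (fun j => x (i.succAbove j) / x i)) := by
  refine ⟨concaveOn_perspective_Ri hψ.1, fun x hx => ?_, fun h hh hfh x hx => ?_⟩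
  all_goals
    have hx0 := Ri_pos hx
    obtain ⟨hyC, hxy⟩ := div_mem_slice hx
    rw [mem_Ri_iff] at hx
    set y : Fin n → ℝ := fun j => x (i.succAbove j) / x i with hy
    have hdot : dotp w x = x i * dotp w (slice i y) := by rw [← dotp_smul, hxy]
    have hwi : 0 < dotp w (slice i y) := by
      rw [dotp_slice]
      have := Finset.sum_nonneg fun j (_ : j ∈ Finset.univ) =>
        mul_nonneg (hw (i.succAbove j)).le (hyC.1 j)
      linarith [hw i]
    have hyz : dotp w (slice i y) + b < zhat := by
      have := hx.2.1
      rw [hdot] at this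
      refine lt_of_mul_lt_mul_left ?_ hx0.le
      linarith
    have hx1 : x i ≤ 1 := hx.1.2 i
  · have hs := hS.slope_mono hσ hb hz (t := dotp w x + b) (s := dotp w (slice i y) + b)
      (by rw [hdot]; linarith [mul_pos hx0 hwi])
      (by rw [hdot]; linarith [mul_le_of_le_one_left hwi.le hx1]) hyz.le
    rw [add_sub_cancel_right, add_sub_cancel_right, div_le_div_iff₀
      (by rw [hdot]; positivity) hwi] at hs
    have h1 : σ (dotp w x + b) ≤ x i * σ (dotp w (slice i y) + b) := by
      refine le_of_mul_le_mul_right ?_ hwi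
      rw [hdot] at hs ⊢
      linarith
    refine h1.trans (mul_le_mul_of_nonneg_left ?_ hx0.le)
    have := hψ.2.1 y hyC
    rwa [dotp_slice, add_assoc]
  · have hslice : ∀ j, i.succAbove j < i → y j < 1 := fun j hj =>
      (div_lt_one hx0).2 (hx.2.2.1 _ hj)
    have hyz' : ∑ j, w (i.succAbove j) * y j + (w i + b) < zhat := by
      rwa [dotp_slice, add_assoc] at hyz
    have hψh : ψ y ≤ h (slice i y) := by
      refine hψ.le_of_concaveOn_cube (l := b) (u := (∑ i, w i) + b)
        (fun j => (hw (i.succAbove j)).le) (w i + b) (fun y hy => ?_) hσ hz.2.1 hz.2.2.1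
        (fun z _ hz => if_neg hz.not_gt) {j | i.succAbove j < i}
        (k := fun y => h (slice i y)) ⟨?_, ?_⟩ (fun y hy hyz hyJ => ?_) hyC hyz' hslice
      · have := dotp_mem_Icc (fun i => (hw i).le) (slice_mem_Icc i hy)
        rw [dotp_slice] at this
        exact ⟨by linarith [this.1], by linarith [this.2]⟩
      · rintro p ⟨hp, hpz, hpJ⟩ q ⟨hq, hqz, hqJ⟩ a c ha hc hac
        have hm := convex_Ri w b zhat i (slice_mem_Ri hp hpz hpJ) (slice_mem_Ri hq hqz hqJ) ha hc hac
        rw [← slice_comb i p q hac, mem_Ri_iff] at hm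
        refine ⟨convex_Icc _ _ hp hq ha hc hac, ?_, fun j hj => ?_⟩
        · have := hm.2.1
          rw [dotp_slice, slice_self] at this
          linarith
        · simpa using hm.2.2.1 _ hj
      · rintro p ⟨hp, hpz, hpJ⟩ q ⟨hq, hqz, hqJ⟩ a c ha hc hac
        have := hh.2 (slice_mem_Ri hp hpz hpJ) (slice_mem_Ri hq hqz hqJ) ha hc hac
        rwa [← slice_comb i p q hac] at this
      · have := hfh _ (slice_mem_Ri hy hyz hyJ)
        simpa only [dotp_slice, add_assoc] using this
    have hpR : slice i y ∈ Ri w b zhat i := slice_mem_Ri hyC hyz' hslice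
    refine (mul_le_mul_of_nonneg_left hψh hx0.le).trans ?_
    rcases hx1.eq_or_lt with h1 | h1
    · rw [h1, one_mul]
      rw [h1, one_smul] at hxy
      rw [hxy]
    have hbd : ∀ ε ∈ Ioo 0 (x i), (x i - ε) / (1 - ε) * h (slice i y) +
        (1 - x i) / (1 - ε) * σ (ε * dotp w (slice i y) + b) ≤ h x := by
      rintro ε ⟨h0, hε⟩
      have hd : 0 < 1 - ε := by linarith
      have hmem : ε • slice i y ∈ Ri w b zhat i := by
        rw [mem_Ri_iff] at hpR ⊢
        refine ⟨⟨fun j => mul_nonneg h0.le (hpR.1.1 j), fun j => ?_⟩, ?_, fun j hj => ?_,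
          fun j => ?_⟩
        · exact mul_le_one₀ (by linarith) (hpR.1.1 j) (hpR.1.2 j)
        · have := mul_lt_mul_of_pos_left hpR.2.1 h0
          rw [dotp_smul, Pi.smul_apply, smul_eq_mul]
          linarith
        · exact mul_lt_mul_of_pos_left (hpR.2.2.1 j hj) h0
        · exact mul_le_mul_of_nonneg_left (hpR.2.2.2 j) h0.le
      have key := hh.2 hpR hmem (div_nonneg (by linarith) hd.le : 0 ≤ (x i - ε) / (1 - ε))
        (div_nonneg (by linarith) hd.le : 0 ≤ (1 - x i) / (1 - ε)) (by field_simp; ring)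
      have e : (x i - ε) / (1 - ε) + (1 - x i) / (1 - ε) * ε = x i := by field_simp; ring
      rw [smul_smul, ← add_smul, e, hxy] at key
      simp only [smul_eq_mul] at key
      refine le_trans ?_ key
      have := hfh _ hmem
      simp only [dotp_smul] at this
      have := mul_le_mul_of_nonneg_left this
        (div_nonneg (by linarith) hd.le : 0 ≤ (1 - x i) / (1 - ε))
      linarith
    have hlim : Tendsto (fun ε => (x i - ε) / (1 - ε) * h (slice i y) +
        (1 - x i) / (1 - ε) * σ (ε * dotp w (slice i y) + b)) (𝓝[>] 0)
        (𝓝 ((x i - 0) / (1 - 0) * h (slice i y) +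
        (1 - x i) / (1 - 0) * σ (0 * dotp w (slice i y) + b))) := by
      refine ContinuousAt.continuousWithinAt (f := fun ε => (x i - ε) / (1 - ε) * h (slice i y) +
        (1 - x i) / (1 - ε) * σ (ε * dotp w (slice i y) + b)) ?_
      have hσc : ContinuousAt (fun ε : ℝ => σ (ε * dotp w (slice i y) + b)) 0 := by fun_prop
      have hc1 : ContinuousAt (fun ε : ℝ => (x i - ε) / (1 - ε)) 0 :=
        ContinuousAt.div (by fun_prop) (by fun_prop) (by norm_num)
      have hc2 : ContinuousAt (fun ε : ℝ => (1 - x i) / (1 - ε)) 0 :=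
        ContinuousAt.div (by fun_prop) (by fun_prop) (by norm_num)
      exact (hc1.mul continuousAt_const).add (hc2.mul hσc)
    have := le_of_tendsto hlim (Filter.mem_of_superset (Ioo_mem_nhdsGT hx0) hbd)
    simpa [hb] using this

theorem stmt13 {n : ℕ} (w : Fin (n+1) → ℝ) (hw : ∀ i, 0 < w i) (b : ℝ)
    (σ : ℝ → ℝ) (hσ : Continuous σ) (hSTFE : STFE σ) (hb : σ b = 0)
    (zhat : ℝ) (htie : IsTiePoint σ b ((∑ i, w i) + b) zhat)
    (ψ : Fin (n+1) → (Fin n → ℝ) → ℝ)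
    (hψ : ∀ i, IsConcaveEnvelope (Set.Icc 0 1)
      (fun y : Fin n → ℝ => σ ((∑ j, w (i.succAbove j) * y j) + w i + b)) (ψ i))
    (g : (Fin (n+1) → ℝ) → ℝ)
    (hgf : ∀ x ∈ Rf w b zhat, g x = σ (dotp w x + b))
    (hgl : ∀ x ∈ Rl w b zhat, g x = σ zhat / (zhat - b) * dotp w x)
    (hgi : ∀ i : Fin (n+1), ∀ x ∈ Ri w b zhat i,
      g x = x i * ψ i (fun j => x (i.succAbove j) / x i)) :
    IsConcaveEnvelope (Rf w b zhat) (fun x => σ (dotp w x + b)) g ∧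
    IsConcaveEnvelope (Rl w b zhat) (fun x => σ (dotp w x + b)) g ∧
    ∀ i : Fin (n+1), IsConcaveEnvelope (Ri w b zhat i) (fun x => σ (dotp w x + b)) g := by
  have hw0 : ∀ i, 0 ≤ w i := fun i => (hw i).le
  refine ⟨(isConcaveEnvelope_Rf hw0 htie.1).congr hgf,
    (isConcaveEnvelope_Rl hw0 hσ hb htie.1).congr hgl, fun i => ?_⟩
  refine (isConcaveEnvelope_Ri hw hσ hSTFE hb htie.1 i ?_).congr (hgi i)
  simpa only [add_assoc] using hψ i
end
end

section
/- Let w ∈ ℝ^n have all entries strictly positive, b ∈ ℝ, and ẑ ∈ ℝ, with regions R_f, R_l, R_i of [0,1]^n defined accordingly. Let ỹ ∈ R_i for some i be such that ỹ_i = 1 and ỹ_j < 1 for all j ≠ i, and let x ∈ (0,1)^n with x ∉ R_f ∪ R_i. Then there exists w̃ ∈ ℝ^n such that (1) w̃ᵀw = 0, (2) x + αw̃ ∈ R_i for some α ≥ 0, and (3) ỹ − εw̃ ∈ R_i for some ε > 0. -/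
noncomputable section

lemma dotp_comm {n : ℕ} (w x : Fin n → ℝ) : dotp w x = dotp x w :=
  dotProduct_comm w x

lemma dotp_sub_smul {n : ℕ} (w x y : Fin n → ℝ) (r : ℝ) :
    dotp w (x - r • y) = dotp w x - r * dotp w y := by
  change w ⬝ᵥ (x - r • y) = w ⬝ᵥ x - r * (w ⬝ᵥ y)
  rw [dotProduct_sub, dotProduct_smul, smul_eq_mul]

lemma dotp_smul_add_single {n : ℕ} (w x : Fin n → ℝ) (t r : ℝ) (i : Fin n) :
    dotp w (t • x + Pi.single i r) = t * dotp w x + w i * r := by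
  change w ⬝ᵥ (t • x + Pi.single i r) = t * (w ⬝ᵥ x) + w i * r
  rw [dotProduct_add, dotProduct_smul, smul_eq_mul, dotProduct_single]

lemma mul_le_dotp {n : ℕ} {w x : Fin n → ℝ} (hw : ∀ j, 0 ≤ w j) (hx : ∀ j, 0 ≤ x j)
    (i : Fin n) : w i * x i ≤ dotp w x :=
  Finset.single_le_sum (f := fun j => w j * x j)
    (fun j _ => mul_nonneg (hw j) (hx j)) (Finset.mem_univ i)

lemma norm_eq_of_forall_le {n : ℕ} {q : Fin n → ℝ} {i : Fin n} (h0 : ∀ j, 0 ≤ q j)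
    (hmax : ∀ j, q j ≤ q i) : ‖q‖ = q i := by
  apply le_antisymm
  · rw [pi_norm_le_iff_of_nonneg (h0 i)]
    intro j
    rw [Real.norm_of_nonneg (h0 j)]
    exact hmax j
  · simpa [Real.norm_of_nonneg (h0 i)] using norm_le_pi_norm q i

lemma mem_Ri_of_forall_lt {n : ℕ} {w : Fin n → ℝ} {b zhat : ℝ} {i : Fin n} {q : Fin n → ℝ}
    (h0 : ∀ j, 0 ≤ q j) (h1 : q i ≤ 1) (hlt : ∀ j, j ≠ i → q j < q i)
    (hd : dotp w q < (zhat - b) * q i) : q ∈ Ri w b zhat i := by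
  have hmax : ∀ j, q j ≤ q i := fun j => by
    rcases eq_or_ne j i with rfl | hj
    · exact le_rfl
    · exact (hlt j hj).le
  refine ⟨⟨h0, fun j => (hmax j).trans h1⟩, ?_, fun j hj => hlt j hj.ne, fun j _ => hmax j⟩
  rw [norm_eq_of_forall_le h0 hmax]
  linarith

/-- From a point with `y i = 1` whose other entries are `< 1`, small steps along a direction
orthogonal to `w` that does not increase coordinate `i` nor decrease the others stay in `Ri`. -/
lemma exists_sub_smul_mem_Ri {n : ℕ} {w : Fin n → ℝ} {b zhat : ℝ} {i : Fin n}
    {y v : Fin n → ℝ} (hy : y ∈ Ri w b zhat i) (hyi : y i = 1) (hyj : ∀ j, j ≠ i → y j < 1)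
    (hwv : dotp w v = 0) (hvi : 0 ≤ v i) (hvj : ∀ j, j ≠ i → v j ≤ 0) :
    ∃ ε : ℝ, 0 < ε ∧ y - ε • v ∈ Ri w b zhat i := by
  obtain ⟨⟨hy0, hy1⟩, hyd, -, -⟩ := hy
  have hmax : ∀ j, y j ≤ y i := fun j => (hy1 j).trans_eq hyi.symm
  rw [norm_eq_of_forall_le hy0 hmax, hyi] at hyd
  have e1 : ∀ᶠ ε in nhds (0 : ℝ), 0 < 1 - ε * v i := by
    have hc : Continuous fun ε : ℝ => 1 - ε * v i := by fun_prop
    exact hc.continuousAt.eventually_const_lt (by simp)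
  have e2 : ∀ᶠ ε in nhds (0 : ℝ), dotp w y < (zhat - b) * (1 - ε * v i) := by
    have hc : Continuous fun ε : ℝ => (zhat - b) * (1 - ε * v i) := by fun_prop
    exact hc.continuousAt.eventually_const_lt (by simp; linarith)
  have e3 : ∀ᶠ ε in nhds (0 : ℝ), ∀ j, j ≠ i → y j - ε * v j < 1 - ε * v i := by
    rw [Filter.eventually_all]
    intro j
    by_cases hj : j = i
    · exact Filter.Eventually.of_forall fun _ h => absurd hj h
    · have hc : Continuous fun ε : ℝ => y j - ε * v j := by fun_prop
      have hc' : Continuous fun ε : ℝ => 1 - ε * v i := by fun_prop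
      filter_upwards [hc.continuousAt.eventually_lt hc'.continuousAt
        (by simpa using hyj j hj)] with ε h _ using h
  obtain ⟨ε, ⟨h1, h2, h3⟩, hε⟩ := ((((e1.and (e2.and e3)).filter_mono
    (nhdsWithin_le_nhds (s := Set.Ioi 0))).and self_mem_nhdsWithin).exists)
  have hε : 0 < ε := hε
  refine ⟨ε, hε, mem_Ri_of_forall_lt (fun j => ?_) ?_ (fun j hj => ?_) ?_⟩
  · rcases eq_or_ne j i with rfl | hj
    · simp only [Pi.sub_apply, Pi.smul_apply, smul_eq_mul, hyi]
      exact h1.le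
    · have := mul_nonpos_of_nonneg_of_nonpos hε.le (hvj j hj)
      have := hy0 j
      simp only [Pi.sub_apply, Pi.smul_apply, smul_eq_mul, Pi.zero_apply] at this ⊢
      linarith
  · have := mul_nonneg hε.le hvi
    simp only [Pi.sub_apply, Pi.smul_apply, smul_eq_mul, hyi]
    linarith
  · simpa [hyi] using h3 j hj
  · rw [dotp_sub_smul, hwv]
    simpa [hyi] using h2

/-- Weight can be moved from the other coordinates to coordinate `i`, keeping `c = wᵀx`. Here
`a` is `w i` and `u` is `x i`; the new coordinate is `s`, the others are scaled by `t`. -/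
lemma exists_coord_scale {a u c d : ℝ} (ha : 0 < a) (hu : 0 < u) (hu1 : u < 1)
    (hauc : a * u ≤ c) (hcd : c < d) (had : a < d) :
    ∃ s t : ℝ, u ≤ s ∧ s ≤ 1 ∧ 0 ≤ t ∧ t ≤ 1 ∧ (t = 0 ∨ s = 1) ∧
      t * (c - a * u) + a * s = c ∧ c < d * s := by
  have hc : 0 < c := (mul_pos ha hu).trans_le hauc
  rcases le_or_gt c a with h | h
  · refine ⟨c / a, 0, ?_, ?_, le_rfl, zero_le_one, Or.inl rfl, ?_, ?_⟩
    · rw [le_div_iff₀ ha]; linarith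
    · rwa [div_le_one ha]
    · field_simp; ring
    · rw [← mul_div_assoc, lt_div_iff₀ ha]
      nlinarith
  · have hau : a * u < a := by nlinarith
    have hpos : 0 < c - a * u := by linarith
    refine ⟨1, (c - a) / (c - a * u), hu1.le, le_rfl, div_nonneg (by linarith) hpos.le,
      ?_, Or.inr rfl, ?_, by linarith⟩
    · rw [div_le_one hpos]; linarith
    · rw [div_mul_cancel₀ _ hpos.ne']; ring

theorem stmt15 {n : ℕ} (w : Fin n → ℝ) (hw : ∀ i, 0 < w i) (b zhat : ℝ)
    (i : Fin n) (yt : Fin n → ℝ) (hyt : yt ∈ Ri w b zhat i)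
    (hyti : yt i = 1) (hytj : ∀ j, j ≠ i → yt j < 1)
    (x : Fin n → ℝ) (hx : ∀ j, x j ∈ Set.Ioo (0 : ℝ) 1)
    (hxnot : x ∉ Rf w b zhat ∪ Ri w b zhat i) :
    ∃ wt : Fin n → ℝ, dotp wt w = 0 ∧
      (∃ α : ℝ, 0 ≤ α ∧ x + α • wt ∈ Ri w b zhat i) ∧
      (∃ ε : ℝ, 0 < ε ∧ yt - ε • wt ∈ Ri w b zhat i) := by
  have hx0 : ∀ j, 0 ≤ x j := fun j => (hx j).1.le
  have hxf : dotp w x < zhat - b := by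
    by_contra! h
    exact hxnot (Or.inl ⟨⟨hx0, fun j => (hx j).2.le⟩, by linarith⟩)
  have hwi : w i < zhat - b := by
    obtain ⟨⟨hy0, hy1⟩, hyd, -, -⟩ := hyt
    rw [norm_eq_of_forall_le hy0 fun j => (hy1 j).trans_eq hyti.symm, hyti] at hyd
    have := mul_le_dotp (fun j => (hw j).le) hy0 i
    rw [hyti] at this
    linarith
  obtain ⟨s, t, hs, hs1, ht, ht1, hts, hsum, hlt⟩ := exists_coord_scale (hw i) (hx i).1 (hx i).2
    (mul_le_dotp (fun j => (hw j).le) hx0 i) hxf hwi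
  set p : Fin n → ℝ := t • x + Pi.single i (s - t * x i) with hp
  have hpi : p i = s := by simp [hp]
  have hpj : ∀ j, j ≠ i → p j = t * x j := fun j hj => by simp [hp, hj]
  have hwp : dotp w p = dotp w x := by
    rw [hp, dotp_smul_add_single]
    linarith
  have hwv : dotp w (p - x) = 0 := by
    simpa [hwp] using dotp_sub_smul w p x 1
  refine ⟨p - x, by rw [dotp_comm, hwv], ⟨1, zero_le_one, ?_⟩,
    exists_sub_smul_mem_Ri hyt hyti hytj hwv ?_ fun j hj => ?_⟩
  · rw [one_smul, add_sub_cancel]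
    refine mem_Ri_of_forall_lt (fun j => ?_) (hpi.trans_le hs1) (fun j hj => ?_) ?_
    · rcases eq_or_ne j i with rfl | hj
      · rw [hpi]
        exact (hx0 j).trans hs
      · rw [hpj j hj]
        exact mul_nonneg ht (hx0 j)
    · rw [hpj j hj, hpi]
      rcases hts with rfl | rfl
      · rw [zero_mul]
        exact (hx i).1.trans_le hs
      · exact (mul_le_of_le_one_left (hx0 j) ht1).trans_lt (hx j).2
    · rwa [hwp, hpi]
  · simpa [hpi] using hs
  · simpa [hpj j hj] using mul_le_of_le_one_left (hx0 j) ht1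
end
end

section
/- Let D ⊆ ℝ^n be a bounded box (a product of compact intervals), w ∈ ℝ^n, b ∈ ℝ, and let σ : ℝ → ℝ be continuous; set f(x) = σ(wᵀx + b). Then the convex hull of the graph of f over D satisfies conv({(x,y) ∈ D × ℝ : y = f(x)}) = {(x,y) ∈ D × ℝ : conv(f,D)(x) ≤ y ≤ conc(f,D)(x)}. -/
noncomputable section

/-- In finite dimension, the convex hull of a compact set is compact. -/
theorem IsCompact.convexHull_of_finiteDimensional {E : Type*} [AddCommGroup E] [Module ℝ E]
    [FiniteDimensional ℝ E] [TopologicalSpace E] [IsTopologicalAddGroup E] [ContinuousSMul ℝ E]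
    {s : Set E} (hs : IsCompact s) : IsCompact (convexHull ℝ s) := by
  let N := Module.finrank ℝ E + 1
  let F : (Fin N → ℝ) × (Fin N → E) → E := fun p => ∑ i, p.1 i • p.2 i
  have hF : Continuous F := by fun_prop
  have hK : IsCompact (stdSimplex ℝ (Fin N) ×ˢ Set.univ.pi fun _ : Fin N => s) :=
    (isCompact_stdSimplex ℝ (Fin N)).prod (isCompact_univ_pi fun _ => hs)
  convert hK.image hF
  apply Set.Subset.antisymm
  · intro x hx
    obtain ⟨ι, _, z, c, hz, hind, hc, hsum, rfl⟩ := eq_pos_convex_span_of_mem_convexHull hx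
    have hcard : Fintype.card ι ≤ Fintype.card (Fin N) := by
      rw [Fintype.card_fin]
      exact hind.card_le_finrank_succ.trans
        (Nat.succ_le_succ (Submodule.finrank_le _))
    obtain ⟨e⟩ := Function.Embedding.nonempty_of_card_le hcard
    obtain ⟨x₀, hx₀⟩ : s.Nonempty := convexHull_nonempty_iff.mp ⟨_, hx⟩
    have hext : ∀ i ∉ Set.range e, Function.extend e c 0 i = 0 := fun i hi => by
      rw [Function.extend_apply' _ _ _ hi, Pi.zero_apply]
    refine ⟨(Function.extend e c 0, Function.extend e z fun _ => x₀), ⟨⟨fun i => ?_, ?_⟩, ?_⟩, ?_⟩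
    · by_cases hi : i ∈ Set.range e
      · obtain ⟨j, rfl⟩ := hi
        dsimp only
        rw [e.injective.extend_apply]
        exact (hc j).le
      · exact (hext i hi).ge
    · rw [← hsum]
      exact (Fintype.sum_of_injective e e.injective _ _ hext
        fun j => (e.injective.extend_apply c 0 j).symm).symm
    · intro i _
      by_cases hi : i ∈ Set.range e
      · obtain ⟨j, rfl⟩ := hi
        dsimp only
        rw [e.injective.extend_apply]
        exact hz ⟨j, rfl⟩
      · dsimp only
        rwa [Function.extend_apply' _ _ _ hi]
    · refine (Fintype.sum_of_injective e e.injective _ _ (fun i hi => ?_) fun j => ?_).symm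
      · dsimp only
        rw [hext i hi, zero_smul]
      · dsimp only
        rw [e.injective.extend_apply, e.injective.extend_apply]
  · rintro _ ⟨⟨c, z⟩, ⟨⟨hc, hsum⟩, hz⟩, rfl⟩
    exact (convex_convexHull ℝ s).sum_mem (fun i _ => hc i) hsum
      fun i _ => subset_convexHull ℝ s (hz i trivial)

/-- Above each point of `S`, a compact convex set containing the graph of `f` over `S`
reaches at least as high as the concave envelope of `f`. -/
theorem IsConcaveEnvelope.exists_mem_ge {E : Type*} [AddCommGroup E] [Module ℝ E]
    [TopologicalSpace E] [T2Space E] {S : Set E} {f ψ : E → ℝ} {C : Set (E × ℝ)}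
    (hψ : IsConcaveEnvelope S f ψ) (hC : IsCompact C) (hCc : Convex ℝ C)
    (hf : ∀ x ∈ S, (x, f x) ∈ C) {x : E} (hx : x ∈ S) :
    ∃ t, ψ x ≤ t ∧ (x, t) ∈ C := by
  have hgreatest : ∀ x, ∃ t, x ∈ S → IsGreatest {t | (x, t) ∈ C} t := by
    intro x
    by_cases hx : x ∈ S
    · have hfib : IsCompact {t | (x, t) ∈ C} :=
        (hC.image continuous_snd).of_isClosed_subset
          (hC.isClosed.preimage (Continuous.prodMk_right x)) fun t ht => ⟨(x, t), ht, rfl⟩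
      obtain ⟨t, ht⟩ := hfib.exists_isGreatest ⟨f x, hf x hx⟩
      exact ⟨t, fun _ => ht⟩
    · exact ⟨0, fun h => absurd h hx⟩
  choose h hh using hgreatest
  have hconc : ConcaveOn ℝ S h := by
    refine ⟨hψ.1.1, fun x hx y hy a b ha hb hab => ?_⟩
    exact (hh _ (hψ.1.1 hx hy ha hb hab)).2 (hCc (hh x hx).1 (hh y hy).1 ha hb hab)
  exact ⟨h x, hψ.2.2 h hconc (fun y hy => (hh y hy).2 (hf y hy)) x hx, (hh x hx).1⟩

theorem IsConvexEnvelope.neg {E : Type*} [AddCommGroup E] [Module ℝ E] {S : Set E}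
    {f φ : E → ℝ} (hφ : IsConvexEnvelope S f φ) : IsConcaveEnvelope S (-f) (-φ) := by
  refine ⟨hφ.1.neg, fun x hx => neg_le_neg (hφ.2.1 x hx), fun h hh hfh x hx => ?_⟩
  exact neg_le.mp (hφ.2.2 (-h) hh.neg (fun y hy => neg_le.mp (hfh y hy)) x hx)

/-- Below each point of `S`, a compact convex set containing the graph of `f` over `S`
reaches at least as low as the convex envelope of `f`. -/
theorem IsConvexEnvelope.exists_mem_le {E : Type*} [AddCommGroup E] [Module ℝ E]
    [TopologicalSpace E] [T2Space E] {S : Set E} {f φ : E → ℝ} {C : Set (E × ℝ)}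
    (hφ : IsConvexEnvelope S f φ) (hC : IsCompact C) (hCc : Convex ℝ C)
    (hf : ∀ x ∈ S, (x, f x) ∈ C) {x : E} (hx : x ∈ S) :
    ∃ t, t ≤ φ x ∧ (x, t) ∈ C := by
  let R : E × ℝ →ₗ[ℝ] E × ℝ := LinearMap.prodMap LinearMap.id (-LinearMap.id)
  have hR : Continuous R := continuous_fst.prodMk continuous_snd.neg
  obtain ⟨t, ht, p, hp, hpt⟩ := hφ.neg.exists_mem_ge (hC.image hR) (hCc.linear_image R)
    (fun y hy => ⟨(y, f y), hf y hy, rfl⟩) hx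
  obtain ⟨h1, h2⟩ := Prod.ext_iff.mp hpt
  refine ⟨p.2, ?_, ?_⟩
  · rw [← show -p.2 = t from h2] at ht
    exact neg_le_neg_iff.mp ht
  · rw [← show p.1 = x from h1]
    exact hp

/-- The convex hull of a compact graph is the region between the two envelopes. -/
theorem convexHull_graphOn_eq_between_envelopes {E : Type*} [AddCommGroup E] [Module ℝ E]
    [TopologicalSpace E] [T2Space E] {S : Set E} {f φ ψ : E → ℝ}
    (hφ : IsConvexEnvelope S f φ) (hψ : IsConcaveEnvelope S f ψ)
    (hC : IsCompact (convexHull ℝ {p : E × ℝ | p.1 ∈ S ∧ p.2 = f p.1})) :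
    convexHull ℝ {p : E × ℝ | p.1 ∈ S ∧ p.2 = f p.1} =
      {p : E × ℝ | p.1 ∈ S ∧ φ p.1 ≤ p.2 ∧ p.2 ≤ ψ p.1} := by
  apply Set.Subset.antisymm
  · refine convexHull_min ?_ ?_
    · rintro ⟨x, y⟩ ⟨hx, hy⟩
      dsimp only at hx hy
      subst hy
      exact ⟨hx, hφ.2.1 x hx, hψ.2.1 x hx⟩
    · have hinter : {p : E × ℝ | p.1 ∈ S ∧ φ p.1 ≤ p.2 ∧ p.2 ≤ ψ p.1} =
          {p : E × ℝ | p.1 ∈ S ∧ φ p.1 ≤ p.2} ∩ {p : E × ℝ | p.1 ∈ S ∧ p.2 ≤ ψ p.1} :=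
        Set.ext fun _ => and_and_left
      rw [hinter]
      exact hφ.1.convex_epigraph.inter hψ.1.convex_hypograph
  · rintro ⟨x, y⟩ ⟨hx, hφy, hyψ⟩
    have hf : ∀ z ∈ S, (z, f z) ∈ convexHull ℝ {p : E × ℝ | p.1 ∈ S ∧ p.2 = f p.1} :=
      fun z hz => subset_convexHull ℝ _ ⟨hz, rfl⟩
    obtain ⟨s, hs, hsC⟩ := hφ.exists_mem_le hC (convex_convexHull ℝ _) hf hx
    obtain ⟨t, ht, htC⟩ := hψ.exists_mem_ge hC (convex_convexHull ℝ _) hf hx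
    have hfib : Convex ℝ {r : ℝ | (x, r) ∈ convexHull ℝ {p : E × ℝ | p.1 ∈ S ∧ p.2 = f p.1}} := by
      intro a ha c hc α β hα hβ hαβ
      have := convex_convexHull ℝ _ ha hc hα hβ hαβ
      rwa [Prod.smul_mk, Prod.smul_mk, Prod.mk_add_mk, Convex.combo_self hαβ] at this
    exact hfib.ordConnected.out hsC htC ⟨hs.trans hφy, hyψ.trans ht⟩

theorem stmt18 {n : ℕ} (l u : Fin n → ℝ) (hlu : l ≤ u)
    (w : Fin n → ℝ) (b : ℝ) (σ : ℝ → ℝ) (hσ : Continuous σ)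
    (φ ψ : (Fin n → ℝ) → ℝ)
    (hφ : IsConvexEnvelope (Set.Icc l u) (fun x => σ (dotp w x + b)) φ)
    (hψ : IsConcaveEnvelope (Set.Icc l u) (fun x => σ (dotp w x + b)) ψ) :
    convexHull ℝ {p : (Fin n → ℝ) × ℝ | p.1 ∈ Set.Icc l u ∧ p.2 = σ (dotp w p.1 + b)} =
      {p : (Fin n → ℝ) × ℝ | p.1 ∈ Set.Icc l u ∧ φ p.1 ≤ p.2 ∧ p.2 ≤ ψ p.1} := by
  refine convexHull_graphOn_eq_between_envelopes hφ hψ (IsCompact.convexHull_of_finiteDimensional ?_)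
  have hf : Continuous fun x : Fin n → ℝ => σ (dotp w x + b) := by
    unfold dotp
    fun_prop
  have hgraph : {p : (Fin n → ℝ) × ℝ | p.1 ∈ Set.Icc l u ∧ p.2 = σ (dotp w p.1 + b)} =
      (fun x => (x, σ (dotp w x + b))) '' Set.Icc l u := by
    ext ⟨x, y⟩
    constructor
    · rintro ⟨hx, hy⟩
      exact ⟨x, hx, Prod.ext rfl hy.symm⟩
    · rintro ⟨z, hz, h⟩
      cases h
      exact ⟨hz, rfl⟩
  rw [hgraph]
  exact isCompact_Icc.image (continuous_id.prodMk hf)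
end
end
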